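/- There do not exist positive integers $a_0, a_1, a_2, a_3$ and an integer $s \ge 6$ such that $3a_0 = 2a_1 + a_3 = 6a_2 + a_3 = a_1 + s\,a_3$ and $\gcd(a_1, a_2)$ divides $3a_0$. -/

import Mathlib

/-- Case IX.3(3) of the Yau–Yu classification yields no well-formed
hypersurface: there are no positive integers `a₀, a₁, a₂, a₃` and `s ≥ 6`
with `3a₀ = 2a₁ + a₃ = 6a₂ + a₃ = a₁ + s a₃` and `gcd(a₁, a₂) ∣ 3a₀`. -/
theorem case_IX_3_3 :
    ¬ ∃ (a₀ a₁ a₂ a₃ s : ℕ), 0 < a₀ ∧ 0 < a₁ ∧ 0 < a₂ ∧ 0 < a₃ ∧ 6 ≤ s ∧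
      3 * a₀ = 2 * a₁ + a₃ ∧ 3 * a₀ = 6 * a₂ + a₃ ∧ 3 * a₀ = a₁ + s * a₃ ∧
      Nat.gcd a₁ a₂ ∣ 3 * a₀ := by
  rintro ⟨a₀, a₁, a₂, a₃, s, -, -, h₂, h₃, hs, e₁, e₂, e₃, hdvd⟩
  obtain rfl : a₁ = 3 * a₂ := by omega
  rw [Nat.gcd_mul_left_left, e₂] at hdvd
  have hle : a₂ ≤ a₃ :=
    Nat.le_of_dvd h₃ ((Nat.dvd_add_right (Dvd.intro_left 6 rfl)).1 hdvd)
  have hmul : 6 * a₃ ≤ s * a₃ := Nat.mul_le_mul_right a₃ hs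
  omega
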